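/- There exists a constant C > 0 depending only on s and c₀ such that for every triple (ξ₁, ξ₂, ξ₃) of real numbers with ξ₁ + ξ₂ + ξ₃ = 0, α₃(ξ₁,ξ₂,ξ₃) ≠ 0 and N_max := max(|ξ₁|,|ξ₂|,|ξ₃|) ≥ N/2, one has |σ₃(ξ₁,ξ₂,ξ₃)| ≤ C·N_max^{2s−2}·N^{2−2s} ≤ C. -/

import Mathlib

open MeasureTheory Real

noncomputable section

/-- An admissible I-method multiplier `m`, with parameters `s`, `N`, `c₀`. -/
structure AdmissibleMultiplier (s N c₀ : ℝ) (m : ℝ → ℝ) : Prop where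
  even : ∀ ξ : ℝ, m (-ξ) = m ξ
  smooth : ContDiff ℝ 2 m
  anti : ∀ ⦃a b : ℝ⦄, 0 ≤ a → a ≤ b → m b ≤ m a
  pos : ∀ ξ : ℝ, 0 < m ξ
  le_one : ∀ ξ : ℝ, m ξ ≤ 1
  eq_one : ∀ ξ : ℝ, |ξ| ≤ N → m ξ = 1
  eq_rpow : ∀ ξ : ℝ, 2 * N ≤ |ξ| → m ξ = N ^ (1 - s) * |ξ| ^ (s - 1)
  cube_mono : ∀ ⦃a b : ℝ⦄, 0 ≤ a → a ≤ b → a ^ 3 * m a ^ 2 ≤ b ^ 3 * m b ^ 2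
  deriv_le : ∀ ξ : ℝ, ξ ≠ 0 → |deriv m ξ| ≤ c₀ * m ξ / |ξ|
  deriv2_le : ∀ ξ : ℝ, ξ ≠ 0 → |deriv (deriv m) ξ| ≤ c₀ * m ξ / ξ ^ 2

/-- The denominator `α₃(ξ₁,ξ₂,ξ₃) = ξ₁³ + 4ξ₂³ + 4ξ₃³`. -/
def alpha3 (ξ₁ ξ₂ ξ₃ : ℝ) : ℝ := ξ₁ ^ 3 + 4 * ξ₂ ^ 3 + 4 * ξ₃ ^ 3

/-- The multiplier `σ₃` associated with `m₁` (and `m₂(ξ) = m₁(2ξ)`); equal to `0`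
by the junk-value convention where `α₃` vanishes. -/
def sigma3 (m₁ : ℝ → ℝ) (ξ₁ ξ₂ ξ₃ : ℝ) : ℝ :=
  (ξ₁ ^ 3 * m₁ ξ₁ ^ 2 + 4 * ξ₂ ^ 3 * m₁ (2 * ξ₂) ^ 2 + 4 * ξ₃ ^ 3 * m₁ (2 * ξ₃) ^ 2) /
    alpha3 ξ₁ ξ₂ ξ₃

/-- The decay profile `(t / N) ^ (2 s - 2)`, which dominates `m²` up to a constant. -/
def decayProfile (s N t : ℝ) : ℝ := t ^ (2 * s - 2) * N ^ (2 - 2 * s)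

section decayProfile

variable {s N : ℝ}

lemma decayProfile_nonneg (hN : 0 < N) {t : ℝ} (ht : 0 < t) : 0 ≤ decayProfile s N t := by
  unfold decayProfile
  positivity

lemma decayProfile_anti (hs1 : s < 1) (hN : 0 < N) {a b : ℝ} (ha : 0 < a) (hab : a ≤ b) :
    decayProfile s N b ≤ decayProfile s N a :=
  mul_le_mul_of_nonneg_right (Real.rpow_le_rpow_of_nonpos ha hab (by linarith)) (by positivity)

lemma decayProfile_self (hN : 0 < N) : decayProfile s N N = 1 := by
  rw [decayProfile, ← Real.rpow_add hN]
  simp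

lemma decayProfile_half_le (hs : 0 ≤ s) (hN : 0 < N) {t : ℝ} (ht : 0 < t) :
    decayProfile s N (t / 2) ≤ 4 * decayProfile s N t := by
  have h2 : (1 / 4 : ℝ) ≤ 2 ^ (2 * s - 2) := by
    calc (1 / 4 : ℝ) = 2 ^ (-2 : ℝ) := by
          rw [Real.rpow_neg (by norm_num)]; norm_num
      _ ≤ 2 ^ (2 * s - 2) :=
          Real.rpow_le_rpow_of_exponent_le (by norm_num) (by linarith)
  have h : decayProfile s N t = 2 ^ (2 * s - 2) * decayProfile s N (t / 2) := by
    unfold decayProfile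
    rw [← mul_assoc, ← Real.mul_rpow (by norm_num) (by positivity)]
    congr 2
    ring
  have := mul_le_mul_of_nonneg_right h2 (decayProfile_nonneg (s := s) hN (half_pos ht))
  linarith

lemma sq_mul_decayProfile_mono (hs : 0 ≤ s) (hN : 0 < N) {a b : ℝ} (ha : 0 < a) (hab : a ≤ b) :
    a ^ 2 * decayProfile s N a ≤ b ^ 2 * decayProfile s N b := by
  have key : ∀ t : ℝ, 0 < t → t ^ 2 * decayProfile s N t = t ^ (2 * s) * N ^ (2 - 2 * s) := by
    intro t ht
    rw [decayProfile, ← mul_assoc, ← Real.rpow_natCast, ← Real.rpow_add ht]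
    congr 2
    push_cast
    ring
  rw [key a ha, key b (ha.trans_le hab)]
  gcongr

end decayProfile

namespace AdmissibleMultiplier

variable {s N c₀ : ℝ} {m : ℝ → ℝ}

lemma apply_abs (hm : AdmissibleMultiplier s N c₀ m) (t : ℝ) : m |t| = m t := by
  rcases abs_choice t with h | h <;> rw [h]
  exact hm.even t

lemma sq_le_decayProfile (hm : AdmissibleMultiplier s N c₀ m) (hs : 0 ≤ s) (hs1 : s < 1)
    (hN : 0 < N) {t : ℝ} (ht : 0 < t) : m t ^ 2 ≤ 4 * decayProfile s N t := by
  rcases le_total (2 * N) t with h | h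
  · have : m t ^ 2 = decayProfile s N t := by
      rw [hm.eq_rpow t (by rwa [abs_of_pos ht]), abs_of_pos ht, decayProfile, mul_pow,
        ← Real.rpow_mul_natCast hN.le, ← Real.rpow_mul_natCast ht.le, mul_comm]
      congr 2 <;> push_cast <;> ring
    linarith [decayProfile_nonneg (s := s) hN ht]
  · have h1 := decayProfile_half_le hs hN (t := 2 * N) (by positivity)
    rw [mul_div_cancel_left₀ _ two_ne_zero, decayProfile_self hN] at h1
    have h2 := decayProfile_anti hs1 hN ht h
    have h3 : m t ^ 2 ≤ 1 := pow_le_one₀ (hm.pos t).le (hm.le_one t)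
    linarith

lemma sq_mul_sq_le (hm : AdmissibleMultiplier s N c₀ m) (hs : 0 ≤ s) (hs1 : s < 1)
    (hN : 0 < N) {t R : ℝ} (hR : 0 < R) (ht : |t| ≤ R) :
    t ^ 2 * m t ^ 2 ≤ 4 * (R ^ 2 * decayProfile s N R) := by
  have hP := decayProfile_nonneg (s := s) hN hR
  rcases eq_or_ne t 0 with rfl | h0
  · simp only [ne_eq, OfNat.ofNat_ne_zero, not_false_eq_true, zero_pow, zero_mul]
    positivity
  · have hpos := abs_pos.mpr h0
    rw [← sq_abs t, ← hm.apply_abs t]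
    calc |t| ^ 2 * m |t| ^ 2 ≤ |t| ^ 2 * (4 * decayProfile s N |t|) := by
          gcongr
          exact hm.sq_le_decayProfile hs hs1 hN hpos
      _ = 4 * (|t| ^ 2 * decayProfile s N |t|) := by ring
      _ ≤ _ := mul_le_mul_of_nonneg_left (sq_mul_decayProfile_mono hs hN hpos ht) (by norm_num)

lemma hasDerivAt (hm : AdmissibleMultiplier s N c₀ m) (t : ℝ) : HasDerivAt m (deriv m t) t :=
  (hm.smooth.differentiable (by norm_num) t).hasDerivAt

lemma hasDerivAt_deriv (hm : AdmissibleMultiplier s N c₀ m) (t : ℝ) :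
    HasDerivAt (deriv m) (deriv (deriv m) t) t :=
  ((show ContDiff ℝ (1 + 1) m from hm.smooth).deriv'.differentiable (by norm_num) t).hasDerivAt

lemma hasDerivAt_cube_mul_sq (hm : AdmissibleMultiplier s N c₀ m) (t : ℝ) :
    HasDerivAt (fun x => x ^ 3 * m x ^ 2)
      (3 * t ^ 2 * m t ^ 2 + 2 * t ^ 3 * m t * deriv m t) t := by
  refine ((hasDerivAt_pow 3 t).mul ((hm.hasDerivAt t).pow 2)).congr_deriv ?_
  simp
  ring

lemma hasDerivAt_deriv_cube_mul_sq (hm : AdmissibleMultiplier s N c₀ m) (t : ℝ) :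
    HasDerivAt (fun x => 3 * x ^ 2 * m x ^ 2 + 2 * x ^ 3 * m x * deriv m x)
      (6 * t * m t ^ 2 + 12 * t ^ 2 * m t * deriv m t +
        2 * t ^ 3 * (deriv m t ^ 2 + m t * deriv (deriv m) t)) t := by
  refine ((((hasDerivAt_pow 2 t).const_mul 3).mul ((hm.hasDerivAt t).pow 2)).add
    ((((hasDerivAt_pow 3 t).const_mul 2).mul (hm.hasDerivAt t)).mul
      (hm.hasDerivAt_deriv t))).congr_deriv ?_
  simp
  ring

lemma abs_mul_abs_deriv_le (hm : AdmissibleMultiplier s N c₀ m) (hc₀ : 0 < c₀) (t : ℝ) :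
    |t| * |deriv m t| ≤ c₀ * m t := by
  rcases eq_or_ne t 0 with rfl | h0
  · simpa using mul_nonneg hc₀.le (hm.pos 0).le
  · have := (le_div_iff₀ (abs_pos.mpr h0)).mp (hm.deriv_le t h0)
    linarith

lemma abs_deriv_cube_mul_sq_le (hm : AdmissibleMultiplier s N c₀ m) (hc₀ : 0 < c₀) (t : ℝ) :
    |3 * t ^ 2 * m t ^ 2 + 2 * t ^ 3 * m t * deriv m t| ≤
      (3 + 2 * c₀) * (t ^ 2 * m t ^ 2) := by
  have hp := hm.pos t
  have h1 : |t * deriv m t| ≤ c₀ * m t := by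
    rw [abs_mul]; exact hm.abs_mul_abs_deriv_le hc₀ t
  calc |3 * t ^ 2 * m t ^ 2 + 2 * t ^ 3 * m t * deriv m t|
      = |3 * (t ^ 2 * m t ^ 2) + 2 * t ^ 2 * m t * (t * deriv m t)| := by congr 1; ring
    _ ≤ |3 * (t ^ 2 * m t ^ 2)| + |2 * t ^ 2 * m t * (t * deriv m t)| := abs_add_le _ _
    _ = 3 * (t ^ 2 * m t ^ 2) + 2 * t ^ 2 * m t * |t * deriv m t| := by
        rw [abs_of_nonneg (by positivity), abs_mul _ (t * _),
          abs_of_nonneg (a := 2 * t ^ 2 * m t) (by positivity)]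
    _ ≤ 3 * (t ^ 2 * m t ^ 2) + 2 * t ^ 2 * m t * (c₀ * m t) := by gcongr
    _ = _ := by ring

lemma abs_deriv2_cube_mul_sq_le (hm : AdmissibleMultiplier s N c₀ m) (hc₀ : 0 < c₀) {t : ℝ}
    (ht : 0 < t) :
    |6 * t * m t ^ 2 + 12 * t ^ 2 * m t * deriv m t +
        2 * t ^ 3 * (deriv m t ^ 2 + m t * deriv (deriv m) t)| ≤
      (6 + 14 * c₀ + 2 * c₀ ^ 2) * (t * m t ^ 2) := by
  have hp := hm.pos t
  have h1 : |t * deriv m t| ≤ c₀ * m t := by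
    rw [abs_mul]; exact hm.abs_mul_abs_deriv_le hc₀ t
  have h2 : |t ^ 2 * deriv (deriv m) t| ≤ c₀ * m t := by
    have := (le_div_iff₀ (by positivity)).mp (hm.deriv2_le t ht.ne')
    rw [abs_mul, abs_of_pos (pow_pos ht 2)]
    linarith
  set u := t * deriv m t
  set v := t ^ 2 * deriv (deriv m) t
  have h3 : |u ^ 2| ≤ (c₀ * m t) ^ 2 := by
    rw [abs_pow]; gcongr
  have h4 : |m t * u| ≤ m t * (c₀ * m t) := by
    rw [abs_mul, abs_of_pos hp]; gcongr
  have h5 : |m t * v| ≤ m t * (c₀ * m t) := by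
    rw [abs_mul, abs_of_pos hp]; gcongr
  rw [abs_le] at h3 h4 h5
  have e : 6 * t * m t ^ 2 + 12 * t ^ 2 * m t * deriv m t +
      2 * t ^ 3 * (deriv m t ^ 2 + m t * deriv (deriv m) t) =
      t * (6 * m t ^ 2 + 12 * (m t * u) + 2 * u ^ 2 + 2 * (m t * v)) := by
    simp only [u, v]; ring
  rw [e, abs_mul, abs_of_pos ht, mul_left_comm (6 + 14 * c₀ + 2 * c₀ ^ 2)]
  refine mul_le_mul_of_nonneg_left ?_ ht.le
  rw [abs_le]
  have := sq_nonneg (m t)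
  constructor <;> linarith [h3.1, h3.2, h4.1, h4.2, h5.1, h5.2]

lemma abs_second_difference_le_of_le_half (hm : AdmissibleMultiplier s N c₀ m) (hs : 0 ≤ s)
    (hs1 : s < 1) (hN : 0 < N) (hc₀ : 0 < c₀) {y h : ℝ} (hy : 0 < y) (hh : 0 < h)
    (hhy : h ≤ y / 2) :
    |(y + h) ^ 3 * m (y + h) ^ 2 + (y - h) ^ 3 * m (y - h) ^ 2 - 2 * (y ^ 3 * m y ^ 2)| ≤
      48 * (6 + 14 * c₀ + 2 * c₀ ^ 2) * (y * h ^ 2 * decayProfile s N y) := by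
  set K := 6 + 14 * c₀ + 2 * c₀ ^ 2
  have hKpos : 0 < K := by positivity
  have hP := decayProfile_nonneg (s := s) hN hy
  set B := K * (3 * y / 2 * (16 * decayProfile s N y)) with hB
  set F' : ℝ → ℝ := fun x => 3 * x ^ 2 * m x ^ 2 + 2 * x ^ 3 * m x * deriv m x with hF'
  have hderiv2 : ∀ t ∈ Set.Icc (y - h) (y + h),
      ‖6 * t * m t ^ 2 + 12 * t ^ 2 * m t * deriv m t +
        2 * t ^ 3 * (deriv m t ^ 2 + m t * deriv (deriv m) t)‖ ≤ B := by
    intro t ht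
    have htl : y / 2 ≤ t := by linarith [ht.1]
    have htpos : 0 < t := by linarith
    refine (hm.abs_deriv2_cube_mul_sq_le hc₀ htpos).trans ?_
    rw [hB]
    gcongr
    · linarith [ht.2]
    · linarith [hm.sq_le_decayProfile hs hs1 hN htpos,
        decayProfile_anti hs1 hN (half_pos hy) htl, decayProfile_half_le hs hN hy]
  have hF'diff : ∀ x ∈ Set.Icc 0 h, ‖F' (y + x) - F' (y - x)‖ ≤ B * (2 * h) := by
    intro x hx
    have := (convex_Icc (y - h) (y + h)).norm_image_sub_le_of_norm_hasDerivWithin_le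
      (fun t _ => (hm.hasDerivAt_deriv_cube_mul_sq t).hasDerivWithinAt) hderiv2
      (x := y - x) (y := y + x) ⟨by linarith [hx.2], by linarith [hx.1]⟩
      ⟨by linarith [hx.1], by linarith [hx.2]⟩
    refine this.trans ?_
    rw [Real.norm_eq_abs, abs_of_nonneg (by linarith [hx.1])]
    gcongr
    linarith [hx.2]
  have hg : ∀ x ∈ Set.Icc 0 h, HasDerivWithinAt
      (fun x => (y + x) ^ 3 * m (y + x) ^ 2 + (y - x) ^ 3 * m (y - x) ^ 2)
      (F' (y + x) - F' (y - x)) (Set.Icc 0 h) x := by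
    intro x _
    have h1 := (hm.hasDerivAt_cube_mul_sq (y + x)).comp_const_add y x
    have h2 := (hm.hasDerivAt_cube_mul_sq (y - x)).comp_const_sub y x
    exact ((h1.add h2).congr_deriv (by simp only [hF']; ring)).hasDerivWithinAt
  have := (convex_Icc 0 h).norm_image_sub_le_of_norm_hasDerivWithin_le hg hF'diff
    (Set.left_mem_Icc.mpr hh.le) (Set.right_mem_Icc.mpr hh.le)
  rw [Real.norm_eq_abs, Real.norm_eq_abs, sub_zero y, sub_zero h, abs_of_pos hh, add_zero] at this
  rw [two_mul (y ^ 3 * m y ^ 2)]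
  refine this.trans (le_of_eq ?_)
  rw [hB]
  ring

lemma abs_second_difference_le_of_half_le (hm : AdmissibleMultiplier s N c₀ m) (hs : 0 ≤ s)
    (hs1 : s < 1) (hN : 0 < N) (hc₀ : 0 < c₀) {y h : ℝ} (hy : 0 < y) (hyh : y / 2 ≤ h) :
    |(y + h) ^ 3 * m (y + h) ^ 2 + (y - h) ^ 3 * m (y - h) ^ 2 - 2 * (y ^ 3 * m y ^ 2)| ≤
      (72 * (3 + 2 * c₀) + 72) * (y * h ^ 2 * decayProfile s N (3 * h)) := by
  have hh : 0 < h := by linarith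
  have h3 : 0 < 3 * h := by linarith
  have hmvt := (convex_Icc (h - y) (h + y)).norm_image_sub_le_of_norm_hasDerivWithin_le
    (C := (3 + 2 * c₀) * (4 * ((3 * h) ^ 2 * decayProfile s N (3 * h))))
    (fun t _ => (hm.hasDerivAt_cube_mul_sq t).hasDerivWithinAt)
    (fun t ht => by
      refine (hm.abs_deriv_cube_mul_sq_le hc₀ t).trans ?_
      gcongr ?_ * ?_
      refine hm.sq_mul_sq_le hs hs1 hN h3 (abs_le.mpr ⟨?_, ?_⟩) <;> linarith [ht.1, ht.2])
    (Set.left_mem_Icc.mpr (by linarith)) (Set.right_mem_Icc.mpr (by linarith))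
  rw [Real.norm_eq_abs, Real.norm_eq_abs, show h + y - (h - y) = 2 * y by ring,
    abs_of_pos (by linarith : 0 < 2 * y)] at hmvt
  have hmid : |2 * (y ^ 3 * m y ^ 2)| ≤
      2 * (y * (4 * ((3 * h) ^ 2 * decayProfile s N (3 * h)))) := by
    have := hm.sq_mul_sq_le hs hs1 hN h3 (t := y) (by rw [abs_of_pos hy]; linarith)
    rw [abs_of_nonneg (by positivity), show y ^ 3 * m y ^ 2 = y * (y ^ 2 * m y ^ 2) by ring]
    gcongr
  have hodd : (y - h) ^ 3 * m (y - h) ^ 2 = -((h - y) ^ 3 * m (h - y) ^ 2) := by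
    rw [← hm.even (y - h), neg_sub]
    ring
  rw [hodd, ← sub_eq_add_neg, add_comm y h]
  refine (abs_sub _ _).trans ((add_le_add hmvt hmid).trans (le_of_eq ?_))
  ring

lemma abs_second_difference_le (hm : AdmissibleMultiplier s N c₀ m) (hs : 0 ≤ s) (hs1 : s < 1)
    (hN : 0 < N) (hc₀ : 0 < c₀) {y h M : ℝ} (hy : y ≠ 0) (hh : h ≠ 0) (hM : 0 < M)
    (hMle : M ≤ max |y| |h|) :
    |(y + h) ^ 3 * m (y + h) ^ 2 + (y - h) ^ 3 * m (y - h) ^ 2 - 2 * (y ^ 3 * m y ^ 2)| ≤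
      (288 + 672 * c₀ + 96 * c₀ ^ 2) * (|y| * h ^ 2 * decayProfile s N M) := by
  wlog hypos : 0 < y generalizing y
  · have := this (y := -y) (neg_ne_zero.mpr hy) (by rwa [abs_neg])
      (neg_pos.mpr (lt_of_le_of_ne (not_lt.mp hypos) hy))
    rw [abs_neg, hm.even y, show -y + h = -(y - h) by ring, show -y - h = -(y + h) by ring,
      hm.even, hm.even] at this
    rw [← abs_neg]
    convert this using 2
    ring
  wlog hhpos : 0 < h generalizing h
  · have := this (h := -h) (neg_ne_zero.mpr hh) (by rwa [abs_neg])
      (neg_pos.mpr (lt_of_le_of_ne (not_lt.mp hhpos) hh))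
    rw [neg_sq, sub_neg_eq_add, ← sub_eq_add_neg] at this
    convert this using 2
    ring
  rw [abs_of_pos hypos, abs_of_pos hhpos] at *
  have hP := decayProfile_nonneg (s := s) hN hM
  rcases le_total h (y / 2) with h1 | h1
  · have hMy : M ≤ y := hMle.trans (max_le le_rfl (by linarith))
    refine (hm.abs_second_difference_le_of_le_half hs hs1 hN hc₀ hypos hhpos h1).trans ?_
    have hPy := decayProfile_nonneg (s := s) hN hypos
    gcongr ?_ * (_ * ?_)
    · linarith
    · exact decayProfile_anti hs1 hN hM hMy
  · have hMh : M ≤ 3 * h := hMle.trans (max_le (by linarith) (by linarith))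
    refine (hm.abs_second_difference_le_of_half_le hs hs1 hN hc₀ hypos h1).trans ?_
    have hPh := decayProfile_nonneg (s := s) hN (t := 3 * h) (by positivity)
    gcongr ?_ * (_ * ?_)
    · nlinarith
    · exact decayProfile_anti hs1 hN hM hMh

end AdmissibleMultiplier

lemma alpha3_eq {ξ₁ ξ₂ ξ₃ : ℝ} (h : ξ₁ + ξ₂ + ξ₃ = 0) :
    alpha3 ξ₁ ξ₂ ξ₃ = 3 * (ξ₂ + ξ₃) * (ξ₂ - ξ₃) ^ 2 := by
  obtain rfl : ξ₁ = -(ξ₂ + ξ₃) := by linarith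
  unfold alpha3
  ring

lemma sigma3_eq {s N c₀ : ℝ} {m : ℝ → ℝ} (hm : AdmissibleMultiplier s N c₀ m) {ξ₁ ξ₂ ξ₃ : ℝ}
    (h : ξ₁ + ξ₂ + ξ₃ = 0) :
    sigma3 m ξ₁ ξ₂ ξ₃ =
      ((2 * ξ₂) ^ 3 * m (2 * ξ₂) ^ 2 + (2 * ξ₃) ^ 3 * m (2 * ξ₃) ^ 2 -
        2 * ((ξ₂ + ξ₃) ^ 3 * m (ξ₂ + ξ₃) ^ 2)) / 2 / (3 * (ξ₂ + ξ₃) * (ξ₂ - ξ₃) ^ 2) := by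
  rw [sigma3, alpha3_eq h]
  obtain rfl : ξ₁ = -(ξ₂ + ξ₃) := by linarith
  rw [hm.even]
  congr 1
  ring

/-- Lemma 3.1 (combined): `|σ₃(ξ₁,ξ₂,ξ₃)| ≤ C·N_max^{2s-2}·N^{2-2s}` and
`|σ₃(ξ₁,ξ₂,ξ₃)| ≤ C`, where `N_max = max(|ξ₁|,|ξ₂|,|ξ₃|) ≥ N/2` and `C = C(s, c₀)`. -/
theorem sigma3_bound (s c₀ : ℝ) (hs : 3 / 4 ≤ s) (hs1 : s < 1) (hc₀ : 0 < c₀) :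
    ∃ C : ℝ, 0 < C ∧
      ∀ N : ℝ, 1 ≤ N → ∀ m₁ : ℝ → ℝ, AdmissibleMultiplier s N c₀ m₁ →
        ∀ ξ₁ ξ₂ ξ₃ : ℝ, ξ₁ + ξ₂ + ξ₃ = 0 → alpha3 ξ₁ ξ₂ ξ₃ ≠ 0 →
          N / 2 ≤ max |ξ₁| (max |ξ₂| |ξ₃|) →
          |sigma3 m₁ ξ₁ ξ₂ ξ₃| ≤
              C * (max |ξ₁| (max |ξ₂| |ξ₃|)) ^ (2 * s - 2) * N ^ (2 - 2 * s) ∧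
          |sigma3 m₁ ξ₁ ξ₂ ξ₃| ≤ C := by
  set K := 288 + 672 * c₀ + 96 * c₀ ^ 2
  have hKpos : 0 < K := by positivity
  refine ⟨4 * K, by positivity, fun N hN1 m hm ξ₁ ξ₂ ξ₃ hsum hα hmax => ?_⟩
  have hN : 0 < N := by linarith
  have hs0 : 0 ≤ s := by linarith
  set M := max |ξ₁| (max |ξ₂| |ξ₃|)
  have hM : 0 < M := by linarith
  rw [alpha3_eq hsum] at hα
  have hy : ξ₂ + ξ₃ ≠ 0 := fun h0 => hα (by rw [h0]; ring)
  have hh : ξ₂ - ξ₃ ≠ 0 := fun h0 => hα (by rw [h0]; ring)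
  have hMle : M ≤ max |ξ₂ + ξ₃| |ξ₂ - ξ₃| := by
    have hadd := abs_add_le (ξ₂ + ξ₃) (ξ₂ - ξ₃)
    have hsub := abs_sub (ξ₂ + ξ₃) (ξ₂ - ξ₃)
    rw [show ξ₂ + ξ₃ + (ξ₂ - ξ₃) = 2 * ξ₂ by ring, abs_mul, abs_two] at hadd
    rw [show ξ₂ + ξ₃ - (ξ₂ - ξ₃) = 2 * ξ₃ by ring, abs_mul, abs_two] at hsub
    have hl := le_max_left |ξ₂ + ξ₃| |ξ₂ - ξ₃|
    have hr := le_max_right |ξ₂ + ξ₃| |ξ₂ - ξ₃|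
    refine max_le ?_ (max_le (by linarith) (by linarith))
    rwa [show ξ₁ = -(ξ₂ + ξ₃) by linarith, abs_neg]
  have hdiff := hm.abs_second_difference_le hs0 hs1 hN hc₀ hy hh hM hMle
  rw [show ξ₂ + ξ₃ + (ξ₂ - ξ₃) = 2 * ξ₂ by ring,
    show ξ₂ + ξ₃ - (ξ₂ - ξ₃) = 2 * ξ₃ by ring] at hdiff
  have hP := decayProfile_nonneg (s := s) hN hM
  have hyh : 0 < |ξ₂ + ξ₃| * (ξ₂ - ξ₃) ^ 2 := by positivity
  have hσ : |sigma3 m ξ₁ ξ₂ ξ₃| ≤ K * decayProfile s N M := by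
    rw [sigma3_eq hm hsum, abs_div, abs_div, abs_two, abs_mul, abs_mul,
      abs_of_pos (three_pos : (0 : ℝ) < 3), abs_of_nonneg (sq_nonneg (ξ₂ - ξ₃)),
      div_le_iff₀ (by positivity), div_le_iff₀ two_pos]
    have : 0 ≤ K * decayProfile s N M * (|ξ₂ + ξ₃| * (ξ₂ - ξ₃) ^ 2) := by positivity
    linarith
  have hPle : decayProfile s N M ≤ 4 := by
    have h1 := decayProfile_half_le hs0 hN hN
    rw [decayProfile_self hN] at h1
    linarith [decayProfile_anti hs1 hN (half_pos hN) hmax]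
  have hKP := mul_nonneg hKpos.le hP
  refine ⟨?_, ?_⟩
  · rw [mul_assoc, ← decayProfile]
    linarith
  · linarith [mul_le_mul_of_nonneg_left hPle hKpos.le]
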